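/- arXiv:1708.05608 — 7 statements merged into one kernel-verified Lean document; each statement's English description precedes it below -/
import Mathlib

section
/- Suppose hypotheses (H1) and (H2) hold, and suppose that for each k ∈ ℤ the linear map ik·D_k − A∘D_k − G_k − a_k·I : X → X has a two-sided bounded inverse N_k ∈ B(X) with sup_{k∈ℤ} ‖N_k‖ < ∞ and sup_{k∈ℤ} ‖k·N_k‖ < ∞. Then sup_{k∈ℤ} ‖k(N_{k+1} − N_k)‖ < ∞; in particular the sequence {N_k}_{k∈ℤ} is M-bounded. -/
/-- Under hypotheses (H1), (H2) and the invertibility and boundedness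
assumptions on `N k = (ik·D_k − A∘D_k − G_k − a_k·I)⁻¹`, one has
`sup_k ‖k(N_{k+1} − N_k)‖ < ∞`; in particular `{N_k}` is M-bounded. -/
theorem Mbounded_resolvent
    {X : Type*} [NormedAddCommGroup X] [NormedSpace ℂ X] [CompleteSpace X]
    (A : X →ₗ[ℂ] X) (L G : ℤ → X →L[ℂ] X) (a : ℤ → ℂ)
    -- (H1)
    (hL : ∃ C : ℝ, ∀ k : ℤ, ‖L k‖ ≤ C)
    (hG : ∃ C : ℝ, ∀ k : ℤ, ‖G k‖ ≤ C)
    (ha : ∃ C : ℝ, ∀ k : ℤ, ‖a k‖ ≤ C)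
    (hP : ∃ C : ℝ, ∀ k : ℤ, ‖(k : ℂ) * (a (k + 1) - a k)‖ ≤ C)
    (hQ : ∃ C : ℝ, ∀ k : ℤ, ‖(k : ℂ) • (L (k + 1) - L k)‖ ≤ C)
    (hR : ∃ C : ℝ, ∀ k : ℤ, ‖(k : ℂ) • (G (k + 1) - G k)‖ ≤ C)
    -- (H2) : `A ∘ (L (k+1) − L k)` is bounded, with uniformly bounded `B k = k·A∘(L (k+1) − L k)`
    (B : ℤ → X →L[ℂ] X)
    (hB : ∀ k : ℤ, (B k : X →ₗ[ℂ] X)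
        = (k : ℂ) • (A ∘ₗ ((L (k + 1) - L k : X →L[ℂ] X) : X →ₗ[ℂ] X)))
    (hBbd : ∃ C : ℝ, ∀ k : ℤ, ‖B k‖ ≤ C)
    -- the operator `ik·D_k − A∘D_k − G_k − a_k·I`
    (Op : ℤ → X →ₗ[ℂ] X)
    (hOp : ∀ k : ℤ, Op k
        = (Complex.I * k) • ((LinearMap.id : X →ₗ[ℂ] X) - (L k : X →ₗ[ℂ] X))
          - A ∘ₗ ((LinearMap.id : X →ₗ[ℂ] X) - (L k : X →ₗ[ℂ] X))
          - (G k : X →ₗ[ℂ] X) - a k • (LinearMap.id : X →ₗ[ℂ] X))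
    -- two-sided bounded inverse
    (N : ℤ → X →L[ℂ] X)
    (hNinv : ∀ k : ℤ, (∀ x : X, Op k (N k x) = x) ∧ (∀ x : X, N k (Op k x) = x))
    (hNbd : ∃ C : ℝ, ∀ k : ℤ, ‖N k‖ ≤ C)
    (hkN : ∃ C : ℝ, ∀ k : ℤ, ‖(k : ℂ) • N k‖ ≤ C) :
    (∃ C : ℝ, ∀ k : ℤ, ‖(k : ℂ) • (N (k + 1) - N k)‖ ≤ C) ∧
    (∃ C : ℝ, ∀ k : ℤ, ‖N k‖ ≤ C) := by
  refine ⟨?_, hNbd⟩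
  obtain ⟨cL, hL⟩ := hL
  obtain ⟨cP, hP⟩ := hP
  obtain ⟨cQ, hQ⟩ := hQ
  obtain ⟨cR, hR⟩ := hR
  obtain ⟨cB, hBbd⟩ := hBbd
  obtain ⟨cN, hNbd⟩ := hNbd
  obtain ⟨cK, hkN⟩ := hkN
  refine ⟨cK * (cQ + (1 + cL)) * cN + cN * (cB + cR + cP) * cN, fun k => ?_⟩
  set Q := (k : ℂ) • (L (k + 1) - L k) with hQdef
  set R := (k : ℂ) • (G (k + 1) - G k) with hRdef
  set p := (k : ℂ) * (a (k + 1) - a k) with hpdef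
  set J := ContinuousLinearMap.id ℂ X with hJ
  set S : X →L[ℂ] X := Complex.I • (Q - (J - L (k + 1))) with hS
  set T : X →L[ℂ] X := -B k + R + p • J with hT
  have hdiff (y : X) : (k : ℂ) • (Op k y - Op (k + 1) y) = (k : ℂ) • S y + T y := by
    have hBy : B k y = (k : ℂ) • (A (L (k + 1) y) - A (L k y)) := by
      simpa using LinearMap.congr_fun (hB k) y
    simp only [hOp, hS, hT, hQdef, hRdef, hpdef, hJ, hBy, LinearMap.sub_apply,
      LinearMap.smul_apply, LinearMap.comp_apply, LinearMap.id_apply, map_sub,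
      ContinuousLinearMap.coe_coe, add_apply, sub_apply, neg_apply, smul_apply,
      ContinuousLinearMap.id_apply]
    push_cast
    module
  have key : (k : ℂ) • (N (k + 1) - N k)
      = ((k : ℂ) • N k) ∘L S ∘L N (k + 1) + N k ∘L T ∘L N (k + 1) := by
    ext x
    have h1 := (hNinv k).2 (N (k + 1) x)
    have h2 := congrArg (N k) ((hNinv (k + 1)).1 x)
    have h3 := congrArg (N k) (hdiff (N (k + 1) x))
    simp only [map_smul, map_sub, map_add, h1, h2] at h3
    simpa using h3
  have hJn : ‖J‖ ≤ 1 := ContinuousLinearMap.norm_id_le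
  have hSn : ‖S‖ ≤ cQ + (1 + cL) := by
    rw [hS, norm_smul, Complex.norm_I, one_mul]
    exact (norm_sub_le _ _).trans
      (add_le_add (hQ k) ((norm_sub_le _ _).trans (add_le_add hJn (hL _))))
  have hTn : ‖T‖ ≤ cB + cR + cP := by
    refine norm_add₃_le.trans (add_le_add (add_le_add ?_ (hR k)) ?_)
    · rw [norm_neg]; exact hBbd k
    · rw [norm_smul]
      exact (mul_le_of_le_one_right (norm_nonneg _) hJn).trans (hP k)
  have comp_le {U V W : X →L[ℂ] X} {u v w : ℝ} (hU : ‖U‖ ≤ u) (hV : ‖V‖ ≤ v) (hW : ‖W‖ ≤ w) :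
      ‖U ∘L V ∘L W‖ ≤ u * v * w := by
    have hu := (norm_nonneg _).trans hU
    have hv := (norm_nonneg _).trans hV
    calc ‖U ∘L V ∘L W‖ ≤ ‖U‖ * (‖V‖ * ‖W‖) :=
          (ContinuousLinearMap.opNorm_comp_le _ _).trans
            (by gcongr; exact ContinuousLinearMap.opNorm_comp_le _ _)
      _ ≤ u * (v * w) := by gcongr
      _ = u * v * w := by ring
  rw [key]
  exact (norm_add_le _ _).trans
    (add_le_add (comp_le (hkN k) hSn (hNbd _)) (comp_le (hNbd k) hTn (hNbd _)))
end

section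
/- Suppose hypotheses (H1) and (H2) hold, and suppose that for each k ∈ ℤ the linear map ik·D_k − A∘D_k − G_k − a_k·I : X → X has a two-sided bounded inverse N_k ∈ B(X) with sup_{k∈ℤ} ‖N_k‖ < ∞ and sup_{k∈ℤ} ‖k·N_k‖ < ∞. Define S_k = ik·N_k. Then sup_{k∈ℤ} ‖k(S_{k+1} − S_k)‖ < ∞; in particular the sequence {S_k}_{k∈ℤ} is M-bounded. -/
/-- A family in a seminormed group whose norms are uniformly bounded. -/
def UniformlyBounded {ι E : Type*} [Norm E] (f : ι → E) : Prop :=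
  ∃ C : ℝ, ∀ i, ‖f i‖ ≤ C

namespace UniformlyBounded

variable {ι E : Type*}

theorem const [Norm E] (c : E) : UniformlyBounded fun _ : ι => c :=
  ⟨‖c‖, fun _ => le_rfl⟩

theorem comp [Norm E] {κ : Type*} {f : ι → E} (hf : UniformlyBounded f) (g : κ → ι) :
    UniformlyBounded fun i => f (g i) :=
  hf.imp fun _ h i => h (g i)

theorem congr [Norm E] {f g : ι → E} (hf : UniformlyBounded f) (h : ∀ i, g i = f i) :
    UniformlyBounded g :=
  funext h ▸ hf

theorem add [SeminormedAddCommGroup E] {f g : ι → E} (hf : UniformlyBounded f)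
    (hg : UniformlyBounded g) : UniformlyBounded fun i => f i + g i := by
  obtain ⟨C, hC⟩ := hf
  obtain ⟨D, hD⟩ := hg
  exact ⟨C + D, fun i => norm_add_le_of_le (hC i) (hD i)⟩

theorem sub [SeminormedAddCommGroup E] {f g : ι → E} (hf : UniformlyBounded f)
    (hg : UniformlyBounded g) : UniformlyBounded fun i => f i - g i := by
  obtain ⟨C, hC⟩ := hf
  obtain ⟨D, hD⟩ := hg
  exact ⟨C + D, fun i => norm_sub_le_of_le (hC i) (hD i)⟩

theorem mul [NonUnitalSeminormedRing E] {f g : ι → E} (hf : UniformlyBounded f)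
    (hg : UniformlyBounded g) : UniformlyBounded fun i => f i * g i := by
  obtain ⟨C, hC⟩ := hf
  obtain ⟨D, hD⟩ := hg
  exact ⟨C * D, fun i => norm_mul_le_of_le (hC i) (hD i)⟩

theorem smul {𝕜 : Type*} [NormedField 𝕜] [SeminormedAddCommGroup E] [NormedSpace 𝕜 E]
    {c : ι → 𝕜} {f : ι → E} (hc : UniformlyBounded c) (hf : UniformlyBounded f) :
    UniformlyBounded fun i => c i • f i := by
  obtain ⟨C, hC⟩ := hc
  obtain ⟨D, hD⟩ := hf
  exact ⟨C * D, fun i => (norm_smul_le _ _).trans <|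
    mul_le_mul (hC i) (hD i) (norm_nonneg _) ((norm_nonneg _).trans (hC i))⟩

end UniformlyBounded


/-- With `S_k = ik·N_k`, one has `sup_k ‖k(S_{k+1} − S_k)‖ < ∞`;
in particular `{S_k}` is M-bounded. -/
theorem Mbounded_S
    {X : Type*} [NormedAddCommGroup X] [NormedSpace ℂ X] [CompleteSpace X]
    (A : X →ₗ[ℂ] X) (L G : ℤ → X →L[ℂ] X) (a : ℤ → ℂ)
    -- (H1)
    (hL : ∃ C : ℝ, ∀ k : ℤ, ‖L k‖ ≤ C)
    (hG : ∃ C : ℝ, ∀ k : ℤ, ‖G k‖ ≤ C)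
    (ha : ∃ C : ℝ, ∀ k : ℤ, ‖a k‖ ≤ C)
    (hP : ∃ C : ℝ, ∀ k : ℤ, ‖(k : ℂ) * (a (k + 1) - a k)‖ ≤ C)
    (hQ : ∃ C : ℝ, ∀ k : ℤ, ‖(k : ℂ) • (L (k + 1) - L k)‖ ≤ C)
    (hR : ∃ C : ℝ, ∀ k : ℤ, ‖(k : ℂ) • (G (k + 1) - G k)‖ ≤ C)
    -- (H2) : `A ∘ (L (k+1) − L k)` is bounded, with uniformly bounded `B k = k·A∘(L (k+1) − L k)`
    (B : ℤ → X →L[ℂ] X)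
    (hB : ∀ k : ℤ, (B k : X →ₗ[ℂ] X)
        = (k : ℂ) • (A ∘ₗ ((L (k + 1) - L k : X →L[ℂ] X) : X →ₗ[ℂ] X)))
    (hBbd : ∃ C : ℝ, ∀ k : ℤ, ‖B k‖ ≤ C)
    -- the operator `ik·D_k − A∘D_k − G_k − a_k·I`
    (Op : ℤ → X →ₗ[ℂ] X)
    (hOp : ∀ k : ℤ, Op k
        = (Complex.I * k) • ((LinearMap.id : X →ₗ[ℂ] X) - (L k : X →ₗ[ℂ] X))
          - A ∘ₗ ((LinearMap.id : X →ₗ[ℂ] X) - (L k : X →ₗ[ℂ] X))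
          - (G k : X →ₗ[ℂ] X) - a k • (LinearMap.id : X →ₗ[ℂ] X))
    -- two-sided bounded inverse
    (N : ℤ → X →L[ℂ] X)
    (hNinv : ∀ k : ℤ, (∀ x : X, Op k (N k x) = x) ∧ (∀ x : X, N k (Op k x) = x))
    (hNbd : ∃ C : ℝ, ∀ k : ℤ, ‖N k‖ ≤ C)
    (hkN : ∃ C : ℝ, ∀ k : ℤ, ‖(k : ℂ) • N k‖ ≤ C) :
    (∃ C : ℝ, ∀ k : ℤ,
        ‖(k : ℂ) • ((Complex.I * ((k : ℤ) + 1 : ℤ)) • N (k + 1) - (Complex.I * k) • N k)‖ ≤ C) ∧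
    (∃ C : ℝ, ∀ k : ℤ, ‖(Complex.I * k) • N k‖ ≤ C) := by
  have hL' : UniformlyBounded L := hL
  have hP' : UniformlyBounded fun k : ℤ => (k : ℂ) * (a (k + 1) - a k) := hP
  have hQ' : UniformlyBounded fun k : ℤ => (k : ℂ) • (L (k + 1) - L k) := hQ
  have hR' : UniformlyBounded fun k : ℤ => (k : ℂ) • (G (k + 1) - G k) := hR
  have hB' : UniformlyBounded B := hBbd
  have hN' : UniformlyBounded N := hNbd
  have hkN' : UniformlyBounded fun k : ℤ => (k : ℂ) • N k := hkN
  have hI : UniformlyBounded fun _ : ℤ => Complex.I := .const _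
  have h1 : UniformlyBounded fun _ : ℤ => (1 : X →L[ℂ] X) := .const _
  -- `k (Op k - Op (k + 1)) = k W k + V k` with `W` and `V` uniformly bounded
  let W : ℤ → X →L[ℂ] X := fun k =>
    Complex.I • ((k : ℂ) • (L (k + 1) - L k) - (1 - L (k + 1)))
  let V : ℤ → X →L[ℂ] X := fun k =>
    (k : ℂ) • (G (k + 1) - G k) - B k + ((k : ℂ) * (a (k + 1) - a k)) • 1
  have hW : UniformlyBounded W := hI.smul (hQ'.sub (h1.sub (hL'.comp (· + 1))))
  have hV : UniformlyBounded V := (hR'.sub hB').add (hP'.smul h1)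
  have hM : UniformlyBounded fun k : ℤ => (k : ℂ) • N (k + 1) := by
    refine ((hkN'.comp (· + 1)).sub (hN'.comp (· + 1))).congr fun k => ?_
    push_cast
    module
  have hdiff (k : ℤ) (z : X) :
      (k : ℂ) • (Op k z - Op (k + 1) z) = (k : ℂ) • W k z + V k z := by
    have hBz : B k z = (k : ℂ) • (A (L (k + 1) z) - A (L k z)) := by
      simpa using LinearMap.congr_fun (hB k) z
    simp only [hOp, W, V, hBz, LinearMap.sub_apply, LinearMap.smul_apply, LinearMap.comp_apply,
      LinearMap.id_apply, ContinuousLinearMap.coe_coe, map_sub, add_apply,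
      sub_apply, smul_apply,
      one_apply_eq_self]
    push_cast
    module
  have hres (k : ℤ) (y : X) :
      (k : ℂ) • (N (k + 1) y - N k y) =
        (k : ℂ) • N (k + 1) (W k (N k y)) + N (k + 1) (V k (N k y)) := by
    have h := congrArg (N (k + 1)) (hdiff k (N k y))
    simpa only [(hNinv k).1, map_smul, map_sub, map_add, (hNinv (k + 1)).2] using h
  refine ⟨?_, ?_⟩
  · change UniformlyBounded fun k : ℤ =>
      (k : ℂ) • ((Complex.I * ((k : ℤ) + 1 : ℤ)) • N (k + 1) - (Complex.I * k) • N k)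
    refine (hI.smul (hM.add (((hM.mul hW).add ((hN'.comp (· + 1)).mul hV)).mul hkN'))).congr
      fun k => ?_
    ext y
    have h : ((k : ℂ) • N (k + 1) * W k + N (k + 1) * V k) (((k : ℂ) • N k) y) =
        (k : ℂ) • (k : ℂ) • (N (k + 1) y - N k y) := by
      rw [hres, smul_apply, map_smul]
      rfl
    change _ = Complex.I • ((k : ℂ) • N (k + 1) y +
      ((k : ℂ) • N (k + 1) * W k + N (k + 1) * V k) (((k : ℂ) • N k) y))
    rw [h]
    simp only [sub_apply, smul_apply]
    push_cast
    module
  · change UniformlyBounded fun k : ℤ => (Complex.I * k) • N k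
    simpa only [smul_smul] using hI.smul hkN'
end

section
/- Suppose hypotheses (H1) and (H2) hold, and suppose that for each k ∈ ℤ the linear map ik·D_k − A∘D_k − G_k − a_k·I : X → X has a two-sided bounded inverse N_k ∈ B(X) with sup_{k∈ℤ} ‖N_k‖ < ∞ and sup_{k∈ℤ} ‖k·N_k‖ < ∞. Define T_k = G_k ∘ N_k. Then the sequence {T_k}_{k∈ℤ} is M-bounded, i.e. sup_{k∈ℤ} ‖T_k‖ < ∞ and sup_{k∈ℤ} ‖k(T_{k+1} − T_k)‖ < ∞. -/
section UniformBounds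

variable {ι 𝕜 E : Type*} [NontriviallyNormedField 𝕜] [SeminormedAddCommGroup E] [NormedSpace 𝕜 E]

theorem exists_norm_add_le {F : Type*} [SeminormedAddCommGroup F] {u v : ι → F}
    (hu : ∃ C : ℝ, ∀ k, ‖u k‖ ≤ C) (hv : ∃ C : ℝ, ∀ k, ‖v k‖ ≤ C) :
    ∃ C : ℝ, ∀ k, ‖u k + v k‖ ≤ C := by
  obtain ⟨C, hC⟩ := hu
  obtain ⟨D, hD⟩ := hv
  exact ⟨C + D, fun k => norm_add_le_of_le (hC k) (hD k)⟩

theorem exists_norm_sub_le {F : Type*} [SeminormedAddCommGroup F] {u v : ι → F}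
    (hu : ∃ C : ℝ, ∀ k, ‖u k‖ ≤ C) (hv : ∃ C : ℝ, ∀ k, ‖v k‖ ≤ C) :
    ∃ C : ℝ, ∀ k, ‖u k - v k‖ ≤ C := by
  obtain ⟨C, hC⟩ := hu
  obtain ⟨D, hD⟩ := hv
  exact ⟨C + D, fun k => norm_sub_le_of_le (hC k) (hD k)⟩

theorem exists_norm_smul_le {c : ι → 𝕜} {u : ι → E}
    (hc : ∃ C : ℝ, ∀ k, ‖c k‖ ≤ C) (hu : ∃ C : ℝ, ∀ k, ‖u k‖ ≤ C) :
    ∃ C : ℝ, ∀ k, ‖c k • u k‖ ≤ C := by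
  obtain ⟨C, hC⟩ := hc
  obtain ⟨D, hD⟩ := hu
  refine ⟨C * D, fun k => (norm_smul_le _ _).trans ?_⟩
  exact mul_le_mul (hC k) (hD k) (norm_nonneg _) ((norm_nonneg _).trans (hC k))

theorem exists_norm_comp_le {u v : ι → E →L[𝕜] E}
    (hu : ∃ C : ℝ, ∀ k, ‖u k‖ ≤ C) (hv : ∃ C : ℝ, ∀ k, ‖v k‖ ≤ C) :
    ∃ C : ℝ, ∀ k, ‖(u k).comp (v k)‖ ≤ C := by
  obtain ⟨C, hC⟩ := hu
  obtain ⟨D, hD⟩ := hv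
  refine ⟨C * D, fun k => ((u k).opNorm_comp_le (v k)).trans ?_⟩
  exact mul_le_mul (hC k) (hD k) (norm_nonneg _) ((norm_nonneg _).trans (hC k))

end UniformBounds


/-- With `T_k = G_k ∘ N_k`, the sequence `{T_k}` is M-bounded:
`sup_k ‖T_k‖ < ∞` and `sup_k ‖k(T_{k+1} − T_k)‖ < ∞`. -/
theorem Mbounded_T
    {X : Type*} [NormedAddCommGroup X] [NormedSpace ℂ X] [CompleteSpace X]
    (A : X →ₗ[ℂ] X) (L G : ℤ → X →L[ℂ] X) (a : ℤ → ℂ)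
    -- (H1)
    (hL : ∃ C : ℝ, ∀ k : ℤ, ‖L k‖ ≤ C)
    (hG : ∃ C : ℝ, ∀ k : ℤ, ‖G k‖ ≤ C)
    (ha : ∃ C : ℝ, ∀ k : ℤ, ‖a k‖ ≤ C)
    (hP : ∃ C : ℝ, ∀ k : ℤ, ‖(k : ℂ) * (a (k + 1) - a k)‖ ≤ C)
    (hQ : ∃ C : ℝ, ∀ k : ℤ, ‖(k : ℂ) • (L (k + 1) - L k)‖ ≤ C)
    (hR : ∃ C : ℝ, ∀ k : ℤ, ‖(k : ℂ) • (G (k + 1) - G k)‖ ≤ C)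
    -- (H2) : `A ∘ (L (k+1) − L k)` is bounded, with uniformly bounded `B k = k·A∘(L (k+1) − L k)`
    (B : ℤ → X →L[ℂ] X)
    (hB : ∀ k : ℤ, (B k : X →ₗ[ℂ] X)
        = (k : ℂ) • (A ∘ₗ ((L (k + 1) - L k : X →L[ℂ] X) : X →ₗ[ℂ] X)))
    (hBbd : ∃ C : ℝ, ∀ k : ℤ, ‖B k‖ ≤ C)
    -- the operator `ik·D_k − A∘D_k − G_k − a_k·I`
    (Op : ℤ → X →ₗ[ℂ] X)
    (hOp : ∀ k : ℤ, Op k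
        = (Complex.I * k) • ((LinearMap.id : X →ₗ[ℂ] X) - (L k : X →ₗ[ℂ] X))
          - A ∘ₗ ((LinearMap.id : X →ₗ[ℂ] X) - (L k : X →ₗ[ℂ] X))
          - (G k : X →ₗ[ℂ] X) - a k • (LinearMap.id : X →ₗ[ℂ] X))
    -- two-sided bounded inverse
    (N : ℤ → X →L[ℂ] X)
    (hNinv : ∀ k : ℤ, (∀ x : X, Op k (N k x) = x) ∧ (∀ x : X, N k (Op k x) = x))
    (hNbd : ∃ C : ℝ, ∀ k : ℤ, ‖N k‖ ≤ C)
    (hkN : ∃ C : ℝ, ∀ k : ℤ, ‖(k : ℂ) • N k‖ ≤ C) :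
    (∃ C : ℝ, ∀ k : ℤ, ‖(G k).comp (N k)‖ ≤ C) ∧
    (∃ C : ℝ, ∀ k : ℤ,
        ‖(k : ℂ) • ((G (k + 1)).comp (N (k + 1)) - (G k).comp (N k))‖ ≤ C) := by
  refine ⟨exists_norm_comp_le hG hNbd, ?_⟩
  have hNs : ∃ C : ℝ, ∀ k : ℤ, ‖N (k + 1)‖ ≤ C := hNbd.imp fun _ h k => h (k + 1)
  have hLs : ∃ C : ℝ, ∀ k : ℤ, ‖L (k + 1)‖ ≤ C := hL.imp fun _ h k => h (k + 1)
  have hid : ∃ C : ℝ, ∀ _ : ℤ, ‖ContinuousLinearMap.id ℂ X‖ ≤ C := ⟨_, fun _ => le_rfl⟩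
  have hI : ∃ C : ℝ, ∀ _ : ℤ, ‖Complex.I‖ ≤ C := ⟨_, fun _ => le_rfl⟩
  -- `N (k+1) - N k = -N (k+1) ∘ (Op (k+1) - Op k) ∘ N k`, multiplied by `k` and expanded
  have hbound := exists_norm_sub_le (exists_norm_comp_le hR hNs)
    (exists_norm_comp_le hG (exists_norm_comp_le hNs (exists_norm_add_le
      (exists_norm_smul_le hI
        (exists_norm_comp_le (exists_norm_sub_le (exists_norm_sub_le hid hLs) hQ) hkN))
      (exists_norm_comp_le
        (exists_norm_sub_le (exists_norm_sub_le hBbd hR) (exists_norm_smul_le hP hid)) hNbd))))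
  refine hbound.imp fun C hC k => ?_
  refine (congrArg norm ?_).trans_le (hC k)
  ext x
  have hBx : B k (N k x) = (k : ℂ) • (A (L (k + 1) (N k x)) - A (L k (N k x))) := by
    simpa using LinearMap.congr_fun (hB k) (N k x)
  have hdiff : (k : ℂ) • (N (k + 1) x - N k x)
      = N (k + 1) ((k : ℂ) • (Op k (N k x) - Op (k + 1) (N k x))) := by
    rw [map_smul, map_sub, (hNinv k).1, (hNinv (k + 1)).2]
  have hexpand : (k : ℂ) • (Op k (N k x) - Op (k + 1) (N k x))
      = -(Complex.I • ((k : ℂ) • N k x - L (k + 1) ((k : ℂ) • N k x)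
            - (k : ℂ) • (L (k + 1) ((k : ℂ) • N k x) - L k ((k : ℂ) • N k x)))
          + (B k (N k x) - (k : ℂ) • (G (k + 1) (N k x) - G k (N k x))
            - ((k : ℂ) * (a (k + 1) - a k)) • N k x)) := by
    rw [hBx]
    simp only [hOp, LinearMap.sub_apply, LinearMap.smul_apply, LinearMap.comp_apply,
      LinearMap.id_apply, ContinuousLinearMap.coe_coe, map_sub, map_smul]
    push_cast
    module
  have hsplit : (k : ℂ) • (G (k + 1) (N (k + 1) x) - G k (N k x))
      = (k : ℂ) • (G (k + 1) (N (k + 1) x) - G k (N (k + 1) x))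
        + G k ((k : ℂ) • (N (k + 1) x - N k x)) := by
    rw [map_smul, map_sub]
    module
  rw [hexpand, map_neg] at hdiff
  rw [hdiff, map_neg, ← sub_eq_add_neg] at hsplit
  exact hsplit
end

section
/- Suppose hypotheses (H1) and (H2) hold, and suppose that for each k ∈ ℤ the linear map ik·D_k − A∘D_k − G_k − a_k·I : X → X has a two-sided bounded inverse N_k ∈ B(X) with sup_{k∈ℤ} ‖N_k‖ < ∞ and sup_{k∈ℤ} ‖k·N_k‖ < ∞. Define F_k = a_k·N_k. Then the sequence {F_k}_{k∈ℤ} is M-bounded, i.e. sup_{k∈ℤ} ‖F_k‖ < ∞ and sup_{k∈ℤ} ‖k(F_{k+1} − F_k)‖ < ∞. -/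
/-- With `F_k = a_k·N_k`, the sequence `{F_k}` is M-bounded:
`sup_k ‖F_k‖ < ∞` and `sup_k ‖k(F_{k+1} − F_k)‖ < ∞`. -/
theorem Mbounded_F
    {X : Type*} [NormedAddCommGroup X] [NormedSpace ℂ X] [CompleteSpace X]
    (A : X →ₗ[ℂ] X) (L G : ℤ → X →L[ℂ] X) (a : ℤ → ℂ)
    -- (H1)
    (hL : ∃ C : ℝ, ∀ k : ℤ, ‖L k‖ ≤ C)
    (hG : ∃ C : ℝ, ∀ k : ℤ, ‖G k‖ ≤ C)
    (ha : ∃ C : ℝ, ∀ k : ℤ, ‖a k‖ ≤ C)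
    (hP : ∃ C : ℝ, ∀ k : ℤ, ‖(k : ℂ) * (a (k + 1) - a k)‖ ≤ C)
    (hQ : ∃ C : ℝ, ∀ k : ℤ, ‖(k : ℂ) • (L (k + 1) - L k)‖ ≤ C)
    (hR : ∃ C : ℝ, ∀ k : ℤ, ‖(k : ℂ) • (G (k + 1) - G k)‖ ≤ C)
    -- (H2) : `A ∘ (L (k+1) − L k)` is bounded, with uniformly bounded `B k = k·A∘(L (k+1) − L k)`
    (B : ℤ → X →L[ℂ] X)
    (hB : ∀ k : ℤ, (B k : X →ₗ[ℂ] X)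
        = (k : ℂ) • (A ∘ₗ ((L (k + 1) - L k : X →L[ℂ] X) : X →ₗ[ℂ] X)))
    (hBbd : ∃ C : ℝ, ∀ k : ℤ, ‖B k‖ ≤ C)
    -- the operator `ik·D_k − A∘D_k − G_k − a_k·I`
    (Op : ℤ → X →ₗ[ℂ] X)
    (hOp : ∀ k : ℤ, Op k
        = (Complex.I * k) • ((LinearMap.id : X →ₗ[ℂ] X) - (L k : X →ₗ[ℂ] X))
          - A ∘ₗ ((LinearMap.id : X →ₗ[ℂ] X) - (L k : X →ₗ[ℂ] X))
          - (G k : X →ₗ[ℂ] X) - a k • (LinearMap.id : X →ₗ[ℂ] X))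
    -- two-sided bounded inverse
    (N : ℤ → X →L[ℂ] X)
    (hNinv : ∀ k : ℤ, (∀ x : X, Op k (N k x) = x) ∧ (∀ x : X, N k (Op k x) = x))
    (hNbd : ∃ C : ℝ, ∀ k : ℤ, ‖N k‖ ≤ C)
    (hkN : ∃ C : ℝ, ∀ k : ℤ, ‖(k : ℂ) • N k‖ ≤ C) :
    (∃ C : ℝ, ∀ k : ℤ, ‖a k • N k‖ ≤ C) ∧
    (∃ C : ℝ, ∀ k : ℤ, ‖(k : ℂ) • (a (k + 1) • N (k + 1) - a k • N k)‖ ≤ C) := by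
  obtain ⟨Ca, ha⟩ := ha
  obtain ⟨C₀, hN⟩ := hNbd
  obtain ⟨C₁, hkN⟩ := hkN
  have hCa : 0 ≤ Ca := (norm_nonneg _).trans (ha 0)
  have hshift (k : ℤ) : ‖(k : ℂ) • N (k + 1)‖ ≤ C₁ + C₀ := by
    have h : (k : ℂ) • N (k + 1) = ((k + 1 : ℤ) : ℂ) • N (k + 1) - N (k + 1) := by
      push_cast
      module
    rw [h]
    exact (norm_sub_le _ _).trans (add_le_add (hkN _) (hN _))
  refine ⟨⟨Ca * C₀, fun k ↦ ?_⟩, ⟨Ca * (C₁ + C₀) + Ca * C₁, fun k ↦ ?_⟩⟩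
  · rw [norm_smul]
    exact mul_le_mul (ha k) (hN k) (norm_nonneg _) hCa
  · rw [smul_sub, smul_comm (k : ℂ) (a (k + 1)), smul_comm (k : ℂ) (a k)]
    refine (norm_sub_le _ _).trans (add_le_add ?_ ?_)
    · rw [norm_smul]
      exact mul_le_mul (ha _) (hshift k) (norm_nonneg _) hCa
    · rw [norm_smul]
      exact mul_le_mul (ha _) (hkN k) (norm_nonneg _) hCa
end

section
/- Suppose that for each k ∈ ℤ the linear map C_k − A∘D_k = ik·D_k − A∘D_k − G_k − a_k·I : X → X has a two-sided bounded inverse N_k ∈ B(X). Then for every k ∈ ℤ one has the identity k(N_{k+1} − N_k) = N_{k+1} ∘ (−ik·I + ik·L_{k+1} + ik·Q_k + R_k + P_k·I − B_k) ∘ N_k. -/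
/-- If `C_k − A∘D_k = ik·D_k − A∘D_k − G_k − a_k·I` has a two-sided
bounded inverse `N_k ∈ B(X)`, then for every `k ∈ ℤ` one has
`k(N_{k+1} − N_k) = N_{k+1} ∘ (−ik·I + ik·L_{k+1} + ik·Q_k + R_k + P_k·I − B_k) ∘ N_k`. -/
theorem resolvent_difference_identity
    {X : Type*} [NormedAddCommGroup X] [NormedSpace ℂ X]
    (A : X →ₗ[ℂ] X) (L G : ℤ → X →L[ℂ] X) (a : ℤ → ℂ)
    -- `B k = k·A∘(L (k+1) − L k)`, assumed to be a bounded operator for each `k`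
    (B : ℤ → X →L[ℂ] X)
    (hB : ∀ k : ℤ, (B k : X →ₗ[ℂ] X)
        = (k : ℂ) • (A ∘ₗ ((L (k + 1) - L k : X →L[ℂ] X) : X →ₗ[ℂ] X)))
    -- the operator `C_k − A∘D_k = ik·D_k − A∘D_k − G_k − a_k·I`
    (Op : ℤ → X →ₗ[ℂ] X)
    (hOp : ∀ k : ℤ, Op k
        = (Complex.I * k) • ((LinearMap.id : X →ₗ[ℂ] X) - (L k : X →ₗ[ℂ] X))
          - A ∘ₗ ((LinearMap.id : X →ₗ[ℂ] X) - (L k : X →ₗ[ℂ] X))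
          - (G k : X →ₗ[ℂ] X) - a k • (LinearMap.id : X →ₗ[ℂ] X))
    -- two-sided bounded inverse
    (N : ℤ → X →L[ℂ] X)
    (hNinv : ∀ k : ℤ, (∀ x : X, Op k (N k x) = x) ∧ (∀ x : X, N k (Op k x) = x)) :
    ∀ k : ℤ, (k : ℂ) • (N (k + 1) - N k)
      = (N (k + 1)).comp
          ((-((Complex.I * k) • (1 : X →L[ℂ] X)) + (Complex.I * k) • L (k + 1)
            + (Complex.I * k) • ((k : ℂ) • (L (k + 1) - L k))
            + (k : ℂ) • (G (k + 1) - G k)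
            + ((k : ℂ) * (a (k + 1) - a k)) • (1 : X →L[ℂ] X)
            - B k).comp (N k)) := by
  intro k
  ext x
  have hBx : B k (N k x) = (k : ℂ) • (A (L (k + 1) (N k x)) - A (L k (N k x))) := by
    simpa using LinearMap.congr_fun (hB k) (N k x)
  have key : (-((Complex.I * k) • (1 : X →L[ℂ] X)) + (Complex.I * k) • L (k + 1)
      + (Complex.I * k) • ((k : ℂ) • (L (k + 1) - L k))
      + (k : ℂ) • (G (k + 1) - G k)
      + ((k : ℂ) * (a (k + 1) - a k)) • (1 : X →L[ℂ] X)
      - B k) (N k x) = (k : ℂ) • (Op k (N k x) - Op (k + 1) (N k x)) := by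
    simp only [hOp, add_apply, sub_apply,
      neg_apply, smul_apply,
      one_apply_eq_self, LinearMap.sub_apply, LinearMap.smul_apply,
      LinearMap.comp_apply, LinearMap.id_apply, ContinuousLinearMap.coe_coe, map_sub, hBx]
    push_cast
    module
  rw [ContinuousLinearMap.comp_apply, ContinuousLinearMap.comp_apply, key, map_smul, map_sub,
    (hNinv k).1, (hNinv (k + 1)).2]
  rfl
end

section
/- Suppose hypotheses (H1) and (H2) hold, and suppose that for each k ∈ ℤ the linear map ik·D_k − A∘D_k − G_k − a_k·I : X → X has a two-sided bounded inverse N_k ∈ B(X) with sup_{k∈ℤ} ‖N_k‖ < ∞ and sup_{k∈ℤ} ‖k·N_k‖ < ∞. Define S_k = ik·N_k. Then the sequence {D_k ∘ S_k}_{k∈ℤ} is M-bounded, i.e. sup_{k∈ℤ} ‖D_k S_k‖ < ∞ and sup_{k∈ℤ} ‖k(D_{k+1}S_{k+1} − D_k S_k)‖ < ∞. -/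
section UniformBounds

variable {ι V : Type*}

theorem exists_norm_add_le_s6 [SeminormedAddCommGroup V] {f g : ι → V}
    (hf : ∃ C : ℝ, ∀ i, ‖f i‖ ≤ C) (hg : ∃ C : ℝ, ∀ i, ‖g i‖ ≤ C) :
    ∃ C : ℝ, ∀ i, ‖f i + g i‖ ≤ C := by
  obtain ⟨c, hc⟩ := hf
  obtain ⟨d, hd⟩ := hg
  exact ⟨c + d, fun i => norm_add_le_of_le (hc i) (hd i)⟩

theorem exists_norm_sub_le_s6 [SeminormedAddCommGroup V] {f g : ι → V}
    (hf : ∃ C : ℝ, ∀ i, ‖f i‖ ≤ C) (hg : ∃ C : ℝ, ∀ i, ‖g i‖ ≤ C) :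
    ∃ C : ℝ, ∀ i, ‖f i - g i‖ ≤ C := by
  obtain ⟨c, hc⟩ := hf
  obtain ⟨d, hd⟩ := hg
  exact ⟨c + d, fun i => norm_sub_le_of_le (hc i) (hd i)⟩

theorem exists_norm_mul_le [SeminormedRing V] {f g : ι → V}
    (hf : ∃ C : ℝ, ∀ i, ‖f i‖ ≤ C) (hg : ∃ C : ℝ, ∀ i, ‖g i‖ ≤ C) :
    ∃ C : ℝ, ∀ i, ‖f i * g i‖ ≤ C := by
  obtain ⟨c, hc⟩ := hf
  obtain ⟨d, hd⟩ := hg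
  exact ⟨c * d, fun i => norm_mul_le_of_le (hc i) (hd i)⟩

theorem exists_norm_smul_le_s6 {𝕜 : Type*} [NormedField 𝕜] [SeminormedAddCommGroup V]
    [NormedSpace 𝕜 V] {c : ι → 𝕜} {f : ι → V}
    (hc : ∃ C : ℝ, ∀ i, ‖c i‖ ≤ C) (hf : ∃ C : ℝ, ∀ i, ‖f i‖ ≤ C) :
    ∃ C : ℝ, ∀ i, ‖c i • f i‖ ≤ C := by
  obtain ⟨c, hc⟩ := hc
  obtain ⟨d, hd⟩ := hf
  exact ⟨c * d, fun i => (norm_smul_le _ _).trans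
    (mul_le_mul (hc i) (hd i) (norm_nonneg _) ((norm_nonneg _).trans (hc i)))⟩

end UniformBounds


/-- With `S_k = ik·N_k` and `D_k = I − L_k`, the sequence `{D_k ∘ S_k}`
is M-bounded: `sup_k ‖D_k S_k‖ < ∞` and `sup_k ‖k(D_{k+1}S_{k+1} − D_k S_k)‖ < ∞`. -/
theorem Mbounded_DS
    {X : Type*} [NormedAddCommGroup X] [NormedSpace ℂ X] [CompleteSpace X]
    (A : X →ₗ[ℂ] X) (L G : ℤ → X →L[ℂ] X) (a : ℤ → ℂ)
    -- (H1)
    (hL : ∃ C : ℝ, ∀ k : ℤ, ‖L k‖ ≤ C)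
    (hG : ∃ C : ℝ, ∀ k : ℤ, ‖G k‖ ≤ C)
    (ha : ∃ C : ℝ, ∀ k : ℤ, ‖a k‖ ≤ C)
    (hP : ∃ C : ℝ, ∀ k : ℤ, ‖(k : ℂ) * (a (k + 1) - a k)‖ ≤ C)
    (hQ : ∃ C : ℝ, ∀ k : ℤ, ‖(k : ℂ) • (L (k + 1) - L k)‖ ≤ C)
    (hR : ∃ C : ℝ, ∀ k : ℤ, ‖(k : ℂ) • (G (k + 1) - G k)‖ ≤ C)
    -- (H2) : `A ∘ (L (k+1) − L k)` is bounded, with uniformly bounded `B k = k·A∘(L (k+1) − L k)`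
    (B : ℤ → X →L[ℂ] X)
    (hB : ∀ k : ℤ, (B k : X →ₗ[ℂ] X)
        = (k : ℂ) • (A ∘ₗ ((L (k + 1) - L k : X →L[ℂ] X) : X →ₗ[ℂ] X)))
    (hBbd : ∃ C : ℝ, ∀ k : ℤ, ‖B k‖ ≤ C)
    -- the operator `ik·D_k − A∘D_k − G_k − a_k·I`
    (Op : ℤ → X →ₗ[ℂ] X)
    (hOp : ∀ k : ℤ, Op k
        = (Complex.I * k) • ((LinearMap.id : X →ₗ[ℂ] X) - (L k : X →ₗ[ℂ] X))
          - A ∘ₗ ((LinearMap.id : X →ₗ[ℂ] X) - (L k : X →ₗ[ℂ] X))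
          - (G k : X →ₗ[ℂ] X) - a k • (LinearMap.id : X →ₗ[ℂ] X))
    -- two-sided bounded inverse
    (N : ℤ → X →L[ℂ] X)
    (hNinv : ∀ k : ℤ, (∀ x : X, Op k (N k x) = x) ∧ (∀ x : X, N k (Op k x) = x))
    (hNbd : ∃ C : ℝ, ∀ k : ℤ, ‖N k‖ ≤ C)
    (hkN : ∃ C : ℝ, ∀ k : ℤ, ‖(k : ℂ) • N k‖ ≤ C) :
    (∃ C : ℝ, ∀ k : ℤ, ‖((1 : X →L[ℂ] X) - L k).comp ((Complex.I * k) • N k)‖ ≤ C) ∧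
    (∃ C : ℝ, ∀ k : ℤ,
        ‖(k : ℂ) • (((1 : X →L[ℂ] X) - L (k + 1)).comp ((Complex.I * ((k : ℤ) + 1 : ℤ)) • N (k + 1))
          - ((1 : X →L[ℂ] X) - L k).comp ((Complex.I * k) • N k))‖ ≤ C) := by
  have hI : ∃ C : ℝ, ∀ _ : ℤ, ‖Complex.I‖ ≤ C := ⟨_, fun _ => le_rfl⟩
  have h1 : ∃ C : ℝ, ∀ _ : ℤ, ‖(1 : X →L[ℂ] X)‖ ≤ C := ⟨_, fun _ => le_rfl⟩
  have hD := exists_norm_sub_le_s6 h1 hL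
  have hD' : ∃ C : ℝ, ∀ k : ℤ, ‖(1 : X →L[ℂ] X) - L (k + 1)‖ ≤ C :=
    hD.imp fun C h k => h (k + 1)
  have hkN' : ∃ C : ℝ, ∀ k : ℤ, ‖(k : ℂ) • N (k + 1)‖ ≤ C := by
    obtain ⟨C, hC⟩ := exists_norm_sub_le_s6 hkN hNbd
    refine ⟨C, fun k => ?_⟩
    refine (congrArg norm ?_).trans_le (hC (k + 1))
    push_cast
    module
  let E : ℤ → X →L[ℂ] X := fun k =>
    B k - (k : ℂ) • (G (k + 1) - G k) - ((k : ℂ) * (a (k + 1) - a k)) • (1 : X →L[ℂ] X)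
  have hE : ∃ C : ℝ, ∀ k, ‖E k‖ ≤ C :=
    exists_norm_sub_le_s6 (exists_norm_sub_le_s6 hBbd hR) (exists_norm_smul_le_s6 hP h1)
  have hOp_sub (k : ℤ) (x : X) : (k : ℂ) • (Op (k + 1) x - Op k x) =
      (Complex.I * k) • (((1 : X →L[ℂ] X) - L (k + 1)) x
        - ((k : ℂ) • (L (k + 1) - L k)) x) + E k x := by
    have hBx : B k x = (k : ℂ) • (A (L (k + 1) x) - A (L k x)) := by
      simpa using LinearMap.congr_fun (hB k) x
    simp only [hOp, E, LinearMap.sub_apply, LinearMap.smul_apply, LinearMap.comp_apply,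
      LinearMap.id_apply, ContinuousLinearMap.coe_coe, map_sub,
      _root_.sub_apply, _root_.smul_apply,
      one_apply_eq_self, hBx]
    push_cast
    module
  have hN_sub (k : ℤ) : (k : ℂ) • (N (k + 1) - N k) =
      -(N (k + 1) * ((Complex.I * k) • ((1 - L (k + 1)) - (k : ℂ) • (L (k + 1) - L k)) + E k)
        * N k) := by
    ext x
    have h := congrArg (N (k + 1)) (hOp_sub k (N k x))
    rw [map_smul, map_sub, (hNinv (k + 1)).2, (hNinv k).1] at h
    have h' : (k : ℂ) • (N (k + 1) x - N k x) = -((k : ℂ) • (N k x - N (k + 1) x)) := by module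
    simp only [_root_.smul_apply, _root_.sub_apply]
    rw [h', h]
    rfl
  have hW : ∃ C : ℝ, ∀ k : ℤ, ‖(k : ℂ) • (k : ℂ) • (N (k + 1) - N k)‖ ≤ C := by
    obtain ⟨C, hC⟩ := exists_norm_add_le_s6
      (exists_norm_mul_le (exists_norm_mul_le hkN'
        (exists_norm_smul_le_s6 hI (exists_norm_sub_le_s6 hD' hQ))) hkN)
      (exists_norm_mul_le (exists_norm_mul_le hkN' hE) hNbd)
    refine ⟨C, fun k => ?_⟩
    rw [hN_sub, smul_neg, norm_neg]
    refine (congrArg norm ?_).trans_le (hC k)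
    simp only [mul_add, add_mul, smul_mul_assoc, mul_smul_comm]
    module
  constructor
  · obtain ⟨C, hC⟩ := exists_norm_mul_le hD (exists_norm_smul_le_s6 hI hkN)
    refine ⟨C, fun k => ?_⟩
    rw [mul_smul]
    exact hC k
  · obtain ⟨C, hC⟩ := exists_norm_smul_le_s6 hI (exists_norm_sub_le_s6
      (exists_norm_add_le_s6 (exists_norm_mul_le hD' hkN') (exists_norm_mul_le hD' hW))
      (exists_norm_mul_le hQ hkN))
    refine ⟨C, fun k => ?_⟩
    refine (congrArg norm ?_).trans_le (hC k)
    simp only [← ContinuousLinearMap.mul_def, sub_mul, mul_sub, one_mul, smul_mul_assoc,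
      mul_smul_comm]
    push_cast
    module
end

section
/- Suppose hypotheses (H1) and (H2) hold, and suppose that for each k ∈ ℤ the linear map ik·D_k − A∘D_k − G_k − a_k·I : X → X has a two-sided bounded inverse N_k ∈ B(X) with sup_{k∈ℤ} ‖N_k‖ < ∞ and sup_{k∈ℤ} ‖k·N_k‖ < ∞. Then for each k ∈ ℤ the linear map A∘D_k∘N_k is a bounded operator on X, it satisfies the identity A∘D_k∘N_k = ik·D_k∘N_k − G_k∘N_k − a_k·N_k − I, and the sequence {A∘D_k∘N_k}_{k∈ℤ} is M-bounded. -/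
/-- A family of elements of a normed group is uniformly bounded in norm. -/
def NormBounded {ι E : Type*} [Norm E] (f : ι → E) : Prop := ∃ C : ℝ, ∀ i, ‖f i‖ ≤ C

namespace NormBounded

variable {ι E : Type*}

theorem const [Norm E] (c : E) : NormBounded (fun _ : ι ↦ c) := ⟨‖c‖, fun _ ↦ le_rfl⟩

theorem comp [Norm E] {κ : Type*} {f : ι → E} (hf : NormBounded f) (g : κ → ι) :
    NormBounded (fun i ↦ f (g i)) :=
  hf.imp fun _ h i ↦ h (g i)

theorem add [SeminormedAddCommGroup E] {f g : ι → E} (hf : NormBounded f) (hg : NormBounded g) :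
    NormBounded (fun i ↦ f i + g i) := by
  obtain ⟨C, hC⟩ := hf
  obtain ⟨D, hD⟩ := hg
  exact ⟨C + D, fun i ↦ norm_add_le_of_le (hC i) (hD i)⟩

theorem sub [SeminormedAddCommGroup E] {f g : ι → E} (hf : NormBounded f) (hg : NormBounded g) :
    NormBounded (fun i ↦ f i - g i) := by
  obtain ⟨C, hC⟩ := hf
  obtain ⟨D, hD⟩ := hg
  exact ⟨C + D, fun i ↦ norm_sub_le_of_le (hC i) (hD i)⟩

theorem mul [NonUnitalSeminormedRing E] {f g : ι → E} (hf : NormBounded f) (hg : NormBounded g) :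
    NormBounded (fun i ↦ f i * g i) := by
  obtain ⟨C, hC⟩ := hf
  obtain ⟨D, hD⟩ := hg
  exact ⟨C * D, fun i ↦ norm_mul_le_of_le (hC i) (hD i)⟩

theorem smul {𝕜 : Type*} [NormedField 𝕜] [SeminormedAddCommGroup E] [NormedSpace 𝕜 E]
    {c : ι → 𝕜} {f : ι → E} (hc : NormBounded c) (hf : NormBounded f) :
    NormBounded (fun i ↦ c i • f i) := by
  obtain ⟨C, hC⟩ := hc
  obtain ⟨D, hD⟩ := hf
  refine ⟨C * D, fun i ↦ ?_⟩
  rw [norm_smul]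
  exact mul_le_mul (hC i) (hD i) (norm_nonneg _) ((norm_nonneg _).trans (hC i))

end NormBounded


/-- `A∘D_k∘N_k` is a bounded operator, it equals
`ik·D_k∘N_k − G_k∘N_k − a_k·N_k − I`, and the sequence `{A∘D_k∘N_k}` is M-bounded. -/
theorem Mbounded_ADN
    {X : Type*} [NormedAddCommGroup X] [NormedSpace ℂ X] [CompleteSpace X]
    (A : X →ₗ[ℂ] X) (L G : ℤ → X →L[ℂ] X) (a : ℤ → ℂ)
    -- (H1)
    (hL : ∃ C : ℝ, ∀ k : ℤ, ‖L k‖ ≤ C)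
    (hG : ∃ C : ℝ, ∀ k : ℤ, ‖G k‖ ≤ C)
    (ha : ∃ C : ℝ, ∀ k : ℤ, ‖a k‖ ≤ C)
    (hP : ∃ C : ℝ, ∀ k : ℤ, ‖(k : ℂ) * (a (k + 1) - a k)‖ ≤ C)
    (hQ : ∃ C : ℝ, ∀ k : ℤ, ‖(k : ℂ) • (L (k + 1) - L k)‖ ≤ C)
    (hR : ∃ C : ℝ, ∀ k : ℤ, ‖(k : ℂ) • (G (k + 1) - G k)‖ ≤ C)
    -- (H2) : `A ∘ (L (k+1) − L k)` is bounded, with uniformly bounded `B k = k·A∘(L (k+1) − L k)`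
    (B : ℤ → X →L[ℂ] X)
    (hB : ∀ k : ℤ, (B k : X →ₗ[ℂ] X)
        = (k : ℂ) • (A ∘ₗ ((L (k + 1) - L k : X →L[ℂ] X) : X →ₗ[ℂ] X)))
    (hBbd : ∃ C : ℝ, ∀ k : ℤ, ‖B k‖ ≤ C)
    -- the operator `ik·D_k − A∘D_k − G_k − a_k·I`
    (Op : ℤ → X →ₗ[ℂ] X)
    (hOp : ∀ k : ℤ, Op k
        = (Complex.I * k) • ((LinearMap.id : X →ₗ[ℂ] X) - (L k : X →ₗ[ℂ] X))
          - A ∘ₗ ((LinearMap.id : X →ₗ[ℂ] X) - (L k : X →ₗ[ℂ] X))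
          - (G k : X →ₗ[ℂ] X) - a k • (LinearMap.id : X →ₗ[ℂ] X))
    -- two-sided bounded inverse
    (N : ℤ → X →L[ℂ] X)
    (hNinv : ∀ k : ℤ, (∀ x : X, Op k (N k x) = x) ∧ (∀ x : X, N k (Op k x) = x))
    (hNbd : ∃ C : ℝ, ∀ k : ℤ, ‖N k‖ ≤ C)
    (hkN : ∃ C : ℝ, ∀ k : ℤ, ‖(k : ℂ) • N k‖ ≤ C) :
    ∃ M : ℤ → X →L[ℂ] X,
      (∀ (k : ℤ) (x : X), M k x = A (((1 : X →L[ℂ] X) - L k) (N k x))) ∧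
      (∀ k : ℤ, M k
          = (Complex.I * k) • (((1 : X →L[ℂ] X) - L k).comp (N k))
            - (G k).comp (N k) - a k • N k - 1) ∧
      (∃ C : ℝ, ∀ k : ℤ, ‖M k‖ ≤ C) ∧
      (∃ C : ℝ, ∀ k : ℤ, ‖(k : ℂ) • (M (k + 1) - M k)‖ ≤ C) := by
  have hOp_apply (k : ℤ) (x : X) : Op k x
      = (Complex.I * k) • (x - L k x) - A (x - L k x) - G k x - a k • x := by
    simp [hOp]
  have hB_apply (k : ℤ) (x : X) : B k x = (k : ℂ) • (A (L (k + 1) x) - A (L k x)) := by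
    simpa using LinearMap.congr_fun (hB k) x
  change NormBounded L at hL
  change NormBounded G at hG
  change NormBounded a at ha
  change NormBounded B at hBbd
  change NormBounded N at hNbd
  set P : ℤ → ℂ := fun k ↦ (k : ℂ) * (a (k + 1) - a k) with hPdef
  set Q : ℤ → X →L[ℂ] X := fun k ↦ (k : ℂ) • (L (k + 1) - L k) with hQdef
  set R : ℤ → X →L[ℂ] X := fun k ↦ (k : ℂ) • (G (k + 1) - G k) with hRdef
  set K : ℤ → X →L[ℂ] X := fun k ↦ (k : ℂ) • N k with hKdef
  change NormBounded P at hP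
  change NormBounded Q at hQ
  change NormBounded R at hR
  change NormBounded K at hkN
  have hD : NormBounded (fun k ↦ 1 - L k) := (NormBounded.const 1).sub hL
  have hI : NormBounded (fun _ : ℤ ↦ Complex.I) := .const _
  have hN' : NormBounded (fun k ↦ N (k + 1)) := hNbd.comp (· + 1)
  have hK' : NormBounded (fun k ↦ K (k + 1)) := hkN.comp (· + 1)
  -- the resolvent identity `k (N (k+1) - N k) = N (k+1) * k (Op k - Op (k+1)) * N k`
  have hdiff (k : ℤ) : (k : ℂ) • (N (k + 1) - N k)
      = N (k + 1) * (Complex.I • (k : ℂ) • (Q k - (1 - L (k + 1)))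
        + (R k + P k • 1 - B k)) * N k := by
    ext x
    have h : (k : ℂ) • (Op k (N k x) - Op (k + 1) (N k x))
        = (Complex.I • (k : ℂ) • (Q k - (1 - L (k + 1))) + (R k + P k • 1 - B k)) (N k x) := by
      simp only [hOp_apply, hPdef, hQdef, hRdef, add_apply, sub_apply, smul_apply,
        one_apply_eq_self, hB_apply, map_sub]
      push_cast
      module
    rw [mul_apply_eq_comp, mul_apply_eq_comp, ← h, map_smul, map_sub,
      (hNinv k).1, (hNinv (k + 1)).2]
    simp
  have hKdiff : NormBounded (fun k : ℤ ↦ (k : ℂ) • (k : ℂ) • (N (k + 1) - N k)) := by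
    have h (k : ℤ) : (k : ℂ) • (k : ℂ) • (N (k + 1) - N k)
        = Complex.I • ((K (k + 1) - N (k + 1)) * (Q k - (1 - L (k + 1))) * K k)
          + N (k + 1) * (R k + P k • 1 - B k) * K k := by
      have hs : K (k + 1) - N (k + 1) = (k : ℂ) • N (k + 1) := by
        simp only [hKdef]
        push_cast
        module
      rw [hdiff, hs]
      simp only [hKdef, mul_add, add_mul, smul_add, mul_smul_comm, smul_mul_assoc]
      module
    simp only [h]
    exact (hI.smul (((hK'.sub hN').mul (hQ.sub (hD.comp (· + 1)))).mul hkN)).add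
      ((hN'.mul ((hR.add (hP.smul (.const 1))).sub hBbd)).mul hkN)
  have hNdiff : NormBounded (fun k : ℤ ↦ (k : ℂ) • (N (k + 1) - N k)) := by
    have h (k : ℤ) : (k : ℂ) • (N (k + 1) - N k) = K (k + 1) - N (k + 1) - K k := by
      simp only [hKdef]
      push_cast
      module
    simp only [h]
    exact (hK'.sub hN').sub hkN
  refine ⟨fun k ↦ (Complex.I * k) • (((1 : X →L[ℂ] X) - L k).comp (N k))
    - (G k).comp (N k) - a k • N k - 1, fun k x ↦ ?_, fun _ ↦ rfl, ?_, ?_⟩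
  · have h := (hNinv k).1 x
    rw [hOp_apply] at h
    simp only [sub_apply, smul_apply, ContinuousLinearMap.comp_apply,
      one_apply_eq_self]
    rw [← sub_eq_zero] at h ⊢
    refine Eq.trans ?_ h
    abel
  · have h (k : ℤ) : (Complex.I * k) • (((1 : X →L[ℂ] X) - L k).comp (N k))
        - (G k).comp (N k) - a k • N k - 1
        = Complex.I • ((1 - L k) * K k) - G k * N k - a k • N k - 1 := by
      simp only [hKdef, ← ContinuousLinearMap.mul_def, mul_smul_comm, mul_smul]
    simp only [h]
    exact (((hI.smul (hD.mul hkN)).sub (hG.mul hNbd)).sub (ha.smul hNbd)).sub (.const 1)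
  · have h (k : ℤ) : (k : ℂ) • (((Complex.I * (k + 1 : ℤ)) •
          (((1 : X →L[ℂ] X) - L (k + 1)).comp (N (k + 1)))
          - (G (k + 1)).comp (N (k + 1)) - a (k + 1) • N (k + 1) - 1)
        - ((Complex.I * k) • (((1 : X →L[ℂ] X) - L k).comp (N k))
          - (G k).comp (N k) - a k • N k - 1))
        = Complex.I • ((1 - L k) * (K (k + 1) - N (k + 1))
            + (1 - L k) * ((k : ℂ) • (k : ℂ) • (N (k + 1) - N k)) - Q k * K (k + 1))
          - (R k * N (k + 1) + G k * ((k : ℂ) • (N (k + 1) - N k)))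
          - (P k • N (k + 1) + a k • ((k : ℂ) • (N (k + 1) - N k))) := by
      simp only [hKdef, hPdef, hQdef, hRdef, ← ContinuousLinearMap.mul_def, sub_mul, mul_sub,
        one_mul, smul_sub, mul_smul_comm, smul_mul_assoc]
      push_cast
      module
    simp only [h]
    exact ((hI.smul (((hD.mul (hK'.sub hN')).add (hD.mul hKdiff)).sub (hQ.mul hK'))).sub
      ((hR.mul hN').add (hG.mul hNdiff))).sub ((hP.smul hN').add (ha.smul hNdiff))
end
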